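/- (Retention covariance asymptotics for the large-retained thinning.) Fix λ > 0 and a Borel probability measure F on [0,∞) with ∫ r^d F(dr) < ∞ that follows a power law with tail exponent α > d. Define h(r) = exp(−λ ∫_{[r,∞)} |B_{r+s}(0)| F(ds)), h₂(u, r₁, r₂) = 0 if u ≤ r₁+r₂ and h₂(u, r₁, r₂) = h(r₁)·h(r₂)·exp(λ ∫_{[max(r₁,r₂),∞)} |B_{r₁+s}(0) ∩ B_{r₂+s}(u·e₁)| F(ds)) if u > r₁+r₂, and q(u,r₁,r₂) = h₂(u,r₁,r₂) − h(r₁)h(r₂). Then for every fixed r₁, r₂ ≥ 0, q(|z|, r₁, r₂)/(λ·c_{α,d}·h(r₁)·h(r₂)·|z|^d·F̄(|z|)) → 1 as |z| → ∞, where c_{α,d} = ∫₀^∞ |B_r(0) ∩ B_r(e₁)|·α·r^{−α−1} dr. -/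

import Mathlib

open MeasureTheory Filter Set Metric ProbabilityTheory

noncomputable section

/-- A measurable positive function is slowly varying at infinity if `ℓ(a t)/ℓ(t) → 1`
as `t → ∞` for every `a > 0`. -/
def SlowlyVarying (ℓ : ℝ → ℝ) : Prop :=
  Measurable ℓ ∧ (∀ x > 0, 0 < ℓ x) ∧
    ∀ a > 0, Tendsto (fun t => ℓ (a * t) / ℓ t) atTop (nhds 1)

/-- Tail function `F̄(x) = F((x,∞))` of a measure on `ℝ`. -/
def tailF (F : Measure ℝ) (x : ℝ) : ℝ := (F (Ioi x)).toReal

/-- `d`-dimensional Euclidean space. -/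
abbrev Euc (d : ℕ) := EuclideanSpace ℝ (Fin d)

/-- The first standard basis vector of `ℝ^d`. -/
def e1 (d : ℕ) : Euc d := if h : 0 < d then EuclideanSpace.single (⟨0, h⟩ : Fin d) 1 else 0

/-- Volume of the closed ball of radius `r` in `ℝ^d`. -/
def ballVol (d : ℕ) (r : ℝ) : ℝ := (volume (closedBall (0 : Euc d) r)).toReal

/-- Volume of the intersection of closed balls `B_r(x)` and `B_s(y)` in `ℝ^d`. -/
def interVol (d : ℕ) (x : Euc d) (r : ℝ) (y : Euc d) (s : ℝ) : ℝ :=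
  (volume (closedBall x r ∩ closedBall y s)).toReal

/-- The constant `c_{α,d} = ∫₀^∞ |B_r(0) ∩ B_r(e₁)| α r^{-α-1} dr`. -/
def cconst (d : ℕ) (α : ℝ) : ℝ :=
  ∫ r in Ioi (0 : ℝ), interVol d 0 r (e1 d) r * (α * r ^ (-α - 1))

/-- `F` follows a power law with tail exponent `α`: `F̄(r) = ℓ(r) r^{-α}` with `ℓ`
slowly varying. -/
def IsPowerLaw (F : Measure ℝ) (α : ℝ) : Prop :=
  ∃ ℓ : ℝ → ℝ, SlowlyVarying ℓ ∧ ∀ x > 0, tailF F x = ℓ x * x ^ (-α)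

/-- Retention probability for the large-retained thinning. -/
def hL (d : ℕ) (lam : ℝ) (F : Measure ℝ) (r : ℝ) : ℝ :=
  Real.exp (-(lam * ∫ s in Ici r, ballVol d (r + s) ∂F))

/-- Pair retention probability for the large-retained thinning. -/
def h2L (d : ℕ) (lam : ℝ) (F : Measure ℝ) (u r₁ r₂ : ℝ) : ℝ :=
  if u ≤ r₁ + r₂ then 0
  else hL d lam F r₁ * hL d lam F r₂ *
    Real.exp (lam * ∫ s in Ici (max r₁ r₂),
      interVol d 0 (r₁ + s) (u • e1 d) (r₂ + s) ∂F)

/-- Retention covariance for the large-retained thinning. -/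
def qL (d : ℕ) (lam : ℝ) (F : Measure ℝ) (u r₁ r₂ : ℝ) : ℝ :=
  h2L d lam F u r₁ r₂ - hL d lam F r₁ * hL d lam F r₂

lemma e1_norm (d : ℕ) (hd : 0 < d) : ‖e1 d‖ = 1 := by
  simp [e1, hd]

lemma tail_antitone (F : Measure ℝ) [IsProbabilityMeasure F] : Antitone (tailF F) := by
  intro a b hab
  exact ENNReal.toReal_mono (measure_ne_top _ _) (measure_mono (Ioi_subset_Ioi hab))

lemma tail_pos (F : Measure ℝ) (α : ℝ) (h : IsPowerLaw F α) (x : ℝ) (hx : 0 < x) :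
    0 < tailF F x := by
  obtain ⟨ℓ, ⟨_, h2, _⟩, h4⟩ := h
  rw [h4 x hx]
  exact mul_pos (h2 x hx) (Real.rpow_pos_of_pos hx _)

lemma tail_ratio (F : Measure ℝ) (α : ℝ) (h : IsPowerLaw F α) (a : ℝ) (ha : 0 < a) :
    Tendsto (fun t => tailF F (a * t) / tailF F t) atTop (nhds (a ^ (-α))) := by
  obtain ⟨ℓ, ⟨_, h2, h3⟩, h4⟩ := h
  have := (h3 a ha).mul_const (a ^ (-α))
  rw [one_mul] at this
  refine this.congr' ?_
  filter_upwards [eventually_gt_atTop 0] with t ht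
  rw [h4 t ht, h4 (a * t) (mul_pos ha ht), Real.mul_rpow ha.le ht.le]
  have := (h2 t ht).ne'
  have := (Real.rpow_pos_of_pos ht (-α)).ne'
  field_simp

/-- If `a(u)/u → M > 0` then `T(a(u))/T(u) → M^{-α}`. -/
lemma tail_ratio_gen (F : Measure ℝ) [IsProbabilityMeasure F] (α : ℝ) (h : IsPowerLaw F α)
    (b : ℝ → ℝ) (M : ℝ) (hM : 0 < M) (hb : Tendsto (fun u => b u / u) atTop (nhds M)) :
    Tendsto (fun u => tailF F (b u) / tailF F u) atTop (nhds (M ^ (-α))) := by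
  have hc : ContinuousAt (fun x : ℝ => x ^ (-α)) M :=
    Real.continuousAt_rpow_const _ _ (Or.inl hM.ne')
  rw [tendsto_order]
  constructor
  · intro c hcM
    have h1 : ∀ᶠ x in nhds M, c < x ^ (-α) := hc.eventually (lt_mem_nhds hcM)
    obtain ⟨x, hx, hMx⟩ := ((h1.filter_mono nhdsWithin_le_nhds).and
      (self_mem_nhdsWithin : Ioi M ∈ nhdsWithin M (Ioi M))).exists
    have hMx' : M < x := hMx
    filter_upwards [(tail_ratio F α h x (hM.trans hMx')).eventually (lt_mem_nhds hx),
      hb.eventually (gt_mem_nhds hMx'), eventually_gt_atTop 0] with u h1 h2 h3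
    refine h1.trans_le ?_
    have := tail_pos F α h u h3
    gcongr
    apply tail_antitone
    rw [div_lt_iff₀ h3] at h2
    exact h2.le
  · intro c hcM
    have h1 : ∀ᶠ x in nhds M, x ^ (-α) < c := hc.eventually (gt_mem_nhds hcM)
    have h1' : ∀ᶠ x in nhds M, 0 < x := lt_mem_nhds hM
    obtain ⟨x, ⟨hx, hx0⟩, hMx⟩ := (((h1.and h1').filter_mono nhdsWithin_le_nhds).and
      (self_mem_nhdsWithin : Iio M ∈ nhdsWithin M (Iio M))).exists
    have hMx' : x < M := hMx
    filter_upwards [(tail_ratio F α h x hx0).eventually (gt_mem_nhds hx),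
      hb.eventually (lt_mem_nhds hMx'), eventually_gt_atTop 0] with u h1 h2 h3
    refine lt_of_le_of_lt ?_ h1
    have := tail_pos F α h u h3
    gcongr
    apply tail_antitone
    rw [lt_div_iff₀ h3] at h2
    exact h2.le

/-- Potter type bound. -/
lemma potter (F : Measure ℝ) [IsProbabilityMeasure F] (α β : ℝ) (h : IsPowerLaw F α)
    (hβ : 0 < β) (hβα : β < α) :
    ∃ C v0 : ℝ, 0 < C ∧ 0 < v0 ∧ ∀ v ≥ v0, ∀ x ≥ (1 / 4 : ℝ),
      tailF F (v * x) ≤ C * x ^ (-β) * tailF F v := by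
  have e1 : (2 : ℝ) ^ (-α) < 2 ^ (-β) :=
    Real.rpow_lt_rpow_of_exponent_lt (by norm_num) (by linarith)
  obtain ⟨v1, hv1⟩ := eventually_atTop.1
    (((tail_ratio F α h 2 (by norm_num)).eventually (gt_mem_nhds e1)).and
      (eventually_gt_atTop 0))
  obtain ⟨v2, hv2⟩ := eventually_atTop.1
    ((tail_ratio F α h (1 / 4) (by norm_num)).eventually (gt_mem_nhds (lt_add_one _)))
  set K := (1 / 4 : ℝ) ^ (-α) + 1 with hK
  have hKpos : 0 < K := by positivity
  have hstep : ∀ n : ℕ, ∀ v ≥ v1, tailF F (2 ^ n * v) ≤ ((2 : ℝ) ^ (-β)) ^ n * tailF F v := by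
    intro n
    induction n with
    | zero => intro v hv; simp
    | succ n ih =>
      intro v hv
      have hv0 := (hv1 v hv).2
      have h2 := (hv1 v hv).1
      rw [div_lt_iff₀ (tail_pos F α h v hv0)] at h2
      have := ih (2 * v) (by linarith)
      calc tailF F (2 ^ (n + 1) * v) = tailF F (2 ^ n * (2 * v)) := by ring_nf
        _ ≤ ((2 : ℝ) ^ (-β)) ^ n * tailF F (2 * v) := this
        _ ≤ ((2 : ℝ) ^ (-β)) ^ n * (2 ^ (-β) * tailF F v) := by gcongr
        _ = _ := by ring
  have hbig : ∀ v ≥ v1, ∀ x ≥ (1 : ℝ), tailF F (x * v) ≤ 2 ^ β * x ^ (-β) * tailF F v := by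
    intro v hv x hx
    have hv0 := (hv1 v hv).2
    obtain ⟨n, hn1, hn2⟩ := exists_nat_pow_near hx (one_lt_two)
    have hx0 : 0 < x := by linarith
    have hT := tail_pos F α h v hv0
    calc tailF F (x * v) ≤ tailF F (2 ^ n * v) := by
          apply tail_antitone; gcongr
      _ ≤ ((2 : ℝ) ^ (-β)) ^ n * tailF F v := hstep n v hv
      _ ≤ _ := by
        gcongr
        have : x / 2 ≤ 2 ^ n := by
          rw [pow_succ] at hn2; linarith
        calc ((2 : ℝ) ^ (-β)) ^ n = ((2 : ℝ) ^ n) ^ (-β) := by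
              rw [← Real.rpow_natCast, ← Real.rpow_mul (by norm_num), mul_comm,
                Real.rpow_mul (by norm_num), Real.rpow_natCast]
          _ ≤ (x / 2) ^ (-β) :=
            Real.rpow_le_rpow_of_nonpos (by positivity) this (by linarith)
          _ = 2 ^ β * x ^ (-β) := by
            rw [Real.div_rpow hx0.le (by norm_num), Real.rpow_neg (by norm_num : (0:ℝ) ≤ 2)]
            field_simp
  refine ⟨2 ^ β * 4 ^ (-β) * K, max (4 * max v1 1) v2, by positivity, by positivity, ?_⟩
  intro v hv x hx
  have hva : 4 * max v1 1 ≤ v := (le_max_left _ _).trans hv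
  have hvb : v2 ≤ v := (le_max_right _ _).trans hv
  have hv1' : v1 ≤ v / 4 := by linarith [le_max_left v1 1]
  have hv0 : 0 < v := by linarith [le_max_right v1 1]
  have hT := tail_pos F α h v hv0
  have hx0 : 0 < x := by linarith
  have h2 := hv2 v hvb
  rw [div_lt_iff₀ hT] at h2
  have h1 := hbig (v / 4) hv1' (4 * x) (by linarith)
  calc tailF F (v * x) = tailF F (4 * x * (v / 4)) := by ring_nf
    _ ≤ _ := h1
    _ ≤ 2 ^ β * (4 * x) ^ (-β) * (K * tailF F v) := by
      gcongr
      rw [show v / 4 = 1 / 4 * v by ring]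
      exact h2.le
    _ = _ := by
      rw [Real.mul_rpow (by norm_num) hx0.le]
      ring

/-- Fubini for lens volumes. -/
lemma lens_fubini (d : ℕ) (ν : Measure ℝ) [SFinite ν] (x : Euc d) (r₁ r₂ : ℝ) :
    ∫⁻ s, volume (closedBall (0 : Euc d) (r₁ + s) ∩ closedBall x (r₂ + s)) ∂ν =
      ∫⁻ y : Euc d, ν (Ici (max (‖y‖ - r₁) (‖y - x‖ - r₂))) := by
  let S : Set (ℝ × Euc d) := {p | ‖p.2‖ ≤ r₁ + p.1 ∧ ‖p.2 - x‖ ≤ r₂ + p.1}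
  have hS : MeasurableSet S := by
    have c1 : IsClosed {p : ℝ × Euc d | ‖p.2‖ ≤ r₁ + p.1} :=
      isClosed_le (by fun_prop) (by fun_prop)
    have c2 : IsClosed {p : ℝ × Euc d | ‖p.2 - x‖ ≤ r₂ + p.1} :=
      isClosed_le (by fun_prop) (by fun_prop)
    exact (c1.inter c2).measurableSet
  have h1 := Measure.prod_apply (μ := ν) (ν := (volume : Measure (Euc d))) hS
  have h2 := Measure.prod_apply_symm (μ := ν) (ν := (volume : Measure (Euc d))) hS
  rw [h1] at h2
  convert h2 using 3 with s y
  · congr 1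
    ext y
    simp [S, dist_eq_norm]
  · congr 1
    ext s
    simp [S, max_le_iff, add_comm]

lemma lens_meas (d : ℕ) (x : Euc d) (r₁ r₂ : ℝ) :
    Measurable fun s : ℝ =>
      volume (closedBall (0 : Euc d) (r₁ + s) ∩ closedBall x (r₂ + s)) := by
  let S : Set (ℝ × Euc d) := {p | ‖p.2‖ ≤ r₁ + p.1 ∧ ‖p.2 - x‖ ≤ r₂ + p.1}
  have hS : MeasurableSet S := by
    have c1 : IsClosed {p : ℝ × Euc d | ‖p.2‖ ≤ r₁ + p.1} :=
      isClosed_le (by fun_prop) (by fun_prop)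
    have c2 : IsClosed {p : ℝ × Euc d | ‖p.2 - x‖ ≤ r₂ + p.1} :=
      isClosed_le (by fun_prop) (by fun_prop)
    exact (c1.inter c2).measurableSet
  have hm := measurable_measure_prodMk_left (ν := (volume : Measure (Euc d))) hS
  have he : ∀ s : ℝ, Prod.mk s ⁻¹' S =
      closedBall (0 : Euc d) (r₁ + s) ∩ closedBall x (r₂ + s) := by
    intro s
    ext y
    simp [S, dist_eq_norm]
  simpa only [he] using hm

lemma lens_lt_top (d : ℕ) (x : Euc d) (r s : ℝ) :
    volume (closedBall (0 : Euc d) r ∩ closedBall x s) < ⊤ :=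
  (measure_mono inter_subset_left).trans_lt measure_closedBall_lt_top

/-- `M(y) = max(|y|, |y - e₁|)`. -/
def MM (d : ℕ) (y : Euc d) : ℝ := max ‖y‖ ‖y - e1 d‖

lemma MM_ge (d : ℕ) (hd : 0 < d) (y : Euc d) : 1 / 2 ≤ MM d y := by
  have h1 := norm_sub_norm_le (e1 d) (e1 d - y)
  rw [sub_sub_cancel, e1_norm d hd, norm_sub_rev] at h1
  have := le_max_left ‖y‖ ‖y - e1 d‖
  have := le_max_right ‖y‖ ‖y - e1 d‖
  unfold MM
  linarith

lemma MM_ge' (d : ℕ) (hd : 0 < d) (y : Euc d) : (1 + ‖y‖) / 4 ≤ MM d y := by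
  have := MM_ge d hd y
  have := le_max_left ‖y‖ ‖y - e1 d‖
  unfold MM at *
  linarith

lemma MM_cont (d : ℕ) : Continuous (MM d) := by unfold MM; fun_prop

lemma MM_integrable (d : ℕ) (hd : 0 < d) (β : ℝ) (hβ : (d : ℝ) < β) :
    Integrable (fun y : Euc d => MM d y ^ (-β)) := by
  have h := (integrable_one_add_norm (E := Euc d) (μ := volume) (r := β)
    (by simpa using hβ)).const_mul ((1 / 4 : ℝ) ^ (-β))
  have hβ0 : 0 ≤ β := (Nat.cast_nonneg d).trans hβ.le
  refine h.mono' ?_ ?_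
  · refine Continuous.aestronglyMeasurable ?_
    exact (MM_cont d).rpow_const fun y => Or.inl (by linarith [MM_ge d hd y])
  · filter_upwards with y
    have := MM_ge d hd y
    rw [Real.norm_of_nonneg (Real.rpow_nonneg (by linarith) _),
      ← Real.mul_rpow (by norm_num) (by positivity)]
    refine Real.rpow_le_rpow_of_nonpos (by positivity) ?_ (by linarith)
    linarith [MM_ge' d hd y]

lemma cconst_eq (d : ℕ) (hd : 0 < d) (α : ℝ) (hα : (d : ℝ) < α) :
    cconst d α = ∫ y : Euc d, MM d y ^ (-α) := by
  have hα0 : 0 < α := (Nat.cast_nonneg d).trans_lt hα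
  let w : ℝ → ENNReal := fun r => ENNReal.ofReal (α * r ^ (-α - 1))
  have hw : Measurable w := by fun_prop
  let V : ℝ → ENNReal := fun r => volume (closedBall (0 : Euc d) r ∩ closedBall (e1 d) r)
  have hV : Measurable V := by simpa using lens_meas d (e1 d) 0 0
  have h1 : cconst d α = ∫ r in Ioi (0 : ℝ), (w r * V r).toReal := by
    unfold cconst
    refine setIntegral_congr_fun measurableSet_Ioi fun r hr => ?_
    have : 0 ≤ α * r ^ (-α - 1) := mul_nonneg hα0.le (Real.rpow_nonneg (le_of_lt hr) _)
    simp only [ENNReal.toReal_mul, w, ENNReal.toReal_ofReal this, interVol, V]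
    ring
  have h2 : (∫⁻ r in Ioi (0 : ℝ), w r * V r) = ∫⁻ y : Euc d, ENNReal.ofReal (MM d y ^ (-α)) := by
    have h3 := lens_fubini d ((volume.restrict (Ioi (0 : ℝ))).withDensity w) (e1 d) 0 0
    simp only [zero_add, sub_zero] at h3
    rw [lintegral_withDensity_eq_lintegral_mul _ hw hV] at h3
    refine h3.trans (lintegral_congr fun y => ?_)
    have hM := MM_ge d hd y
    have hM0 : 0 < MM d y := by linarith
    rw [withDensity_apply _ measurableSet_Ici, Measure.restrict_restrict measurableSet_Ici,
      inter_eq_left.2 (show Ici (max ‖y‖ ‖y - e1 d‖) ⊆ Ioi 0 from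
        fun t ht => lt_of_lt_of_le hM0 ht),
      setLIntegral_congr (Ioi_ae_eq_Ici (a := max ‖y‖ ‖y - e1 d‖)).symm,
      ← ofReal_integral_eq_lintegral_ofReal]
    · rw [integral_const_mul, ← MM, integral_Ioi_rpow_of_lt (by linarith) hM0]
      congr 1
      rw [show -α - 1 + 1 = -α by ring]
      field_simp
    · exact (integrableOn_Ioi_rpow_of_lt (by linarith) hM0).const_mul α
    · refine (ae_restrict_iff' measurableSet_Ioi).2 (ae_of_all _ fun t ht => ?_)
      have : 0 < t := lt_trans hM0 ht
      show 0 ≤ α * t ^ (-α - 1)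
      positivity
  rw [h1, integral_toReal (f := fun r => w r * V r) (hw.mul hV).aemeasurable, h2, integral_eq_lintegral_of_nonneg_ae]
  · exact ae_of_all _ fun y => Real.rpow_nonneg (by linarith [MM_ge d hd y]) _
  · exact (MM_integrable d hd α hα).1
  · exact ae_of_all _ fun r => ENNReal.mul_lt_top ENNReal.ofReal_lt_top (lens_lt_top d _ _ _)

lemma cconst_pos (d : ℕ) (hd : 0 < d) (α : ℝ) (hα : (d : ℝ) < α) : 0 < cconst d α := by
  rw [cconst_eq d hd α hα, integral_pos_iff_support_of_nonneg]
  · have : Function.support (fun y : Euc d => MM d y ^ (-α)) = univ := by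
      ext y
      have := MM_ge d hd y
      simpa using (Real.rpow_pos_of_pos (by linarith) _).ne'
    rw [this]
    exact isOpen_univ.measure_pos _ univ_nonempty
  · exact fun y => Real.rpow_nonneg (by linarith [MM_ge d hd y]) _
  · exact MM_integrable d hd α hα

/-- The exponent integral. -/
def II (d : ℕ) (F : Measure ℝ) (r₁ r₂ u : ℝ) : ℝ :=
  ∫ s in Ici (max r₁ r₂), interVol d 0 (r₁ + s) (u • e1 d) (r₂ + s) ∂F

/-- The threshold radius. -/
def bb (d : ℕ) (r₁ r₂ u : ℝ) (y : Euc d) : ℝ :=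
  max (max (u * ‖y‖ - r₁) (u * ‖y - e1 d‖ - r₂)) (max r₁ r₂)

lemma Ici_meas (F : Measure ℝ) [IsProbabilityMeasure F] :
    Measurable fun a : ℝ => (F (Ici a)).toReal := by
  apply Antitone.measurable
  intro a b hab
  exact ENNReal.toReal_mono (measure_ne_top _ _) (measure_mono (Ici_subset_Ici.2 hab))

lemma II_eq (d : ℕ) (F : Measure ℝ) [IsProbabilityMeasure F] (r₁ r₂ u : ℝ) (hu : 0 < u) :
    II d F r₁ r₂ u = u ^ d * ∫ y : Euc d, (F (Ici (bb d r₁ r₂ u y))).toReal := by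
  unfold II interVol
  rw [integral_toReal (lens_meas d _ r₁ r₂).aemeasurable
    (ae_of_all _ fun s => lens_lt_top d _ _ _), lens_fubini]
  have h1 : ∀ y : Euc d, (F.restrict (Ici (max r₁ r₂)))
      (Ici (max (‖y‖ - r₁) (‖y - u • e1 d‖ - r₂))) =
      F (Ici (max (max (‖y‖ - r₁) (‖y - u • e1 d‖ - r₂)) (max r₁ r₂))) := by
    intro y
    rw [Measure.restrict_apply measurableSet_Ici, Ici_inter_Ici]
  simp_rw [h1]
  rw [← integral_toReal]
  · have h2 := Measure.integral_comp_smul (volume : Measure (Euc d))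
      (fun y => (F (Ici (max (max (‖y‖ - r₁) (‖y - u • e1 d‖ - r₂)) (max r₁ r₂)))).toReal) u
    have h3 : ∀ y : Euc d, bb d r₁ r₂ u y =
        max (max (‖u • y‖ - r₁) (‖u • y - u • e1 d‖ - r₂)) (max r₁ r₂) := by
      intro y
      rw [← smul_sub, norm_smul, norm_smul, Real.norm_of_nonneg hu.le, bb]
    simp_rw [h3]
    rw [h2]
    simp only [finrank_euclideanSpace, Fintype.card_fin, smul_eq_mul]
    rw [abs_of_pos (by positivity)]
    field_simp
  · refine AEMeasurable.congr (f := fun y : Euc d => ENNReal.ofReal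
      ((F (Ici (max (max (‖y‖ - r₁) (‖y - u • e1 d‖ - r₂)) (max r₁ r₂)))).toReal)) ?_ ?_
    · refine (ENNReal.measurable_ofReal.comp ((Ici_meas F).comp ?_)).aemeasurable
      fun_prop
    · exact ae_of_all _ fun y => ENNReal.ofReal_toReal (measure_ne_top _ _)
  · exact ae_of_all _ fun y => measure_lt_top _ _

lemma tail_le_Ici (F : Measure ℝ) [IsProbabilityMeasure F] (a : ℝ) :
    tailF F a ≤ (F (Ici a)).toReal :=
  ENNReal.toReal_mono (measure_ne_top _ _) (measure_mono Ioi_subset_Ici_self)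

lemma Ici_le_tail (F : Measure ℝ) [IsProbabilityMeasure F] (a : ℝ) :
    (F (Ici a)).toReal ≤ tailF F (a - 1) :=
  ENNReal.toReal_mono (measure_ne_top _ _)
    (measure_mono fun x hx => lt_of_lt_of_le (sub_one_lt a) hx)

lemma bb_lim (d : ℕ) (hd : 0 < d) (r₁ r₂ c : ℝ) (y : Euc d) :
    Tendsto (fun u => (bb d r₁ r₂ u y - c) / u) atTop (nhds (MM d y)) := by
  have h0 : ∀ r : ℝ, Tendsto (fun u : ℝ => r / u) atTop (nhds 0) := fun r =>
    tendsto_const_nhds.div_atTop tendsto_id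
  have h1 : Tendsto (fun u : ℝ => max (max (‖y‖ - r₁ / u) (‖y - e1 d‖ - r₂ / u))
      (max r₁ r₂ / u) - c / u) atTop
      (nhds (max (max (‖y‖ - 0) (‖y - e1 d‖ - 0)) 0 - 0)) :=
    ((((tendsto_const_nhds.sub (h0 r₁)).max (tendsto_const_nhds.sub (h0 r₂))).max
      (h0 _)).sub (h0 c))
  have h2 : max (max (‖y‖ - 0) (‖y - e1 d‖ - 0)) 0 - 0 = MM d y := by
    have := MM_ge d hd y
    simp only [sub_zero]
    rw [← MM, max_eq_left (by linarith)]
  rw [h2] at h1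
  refine h1.congr' ?_
  filter_upwards [eventually_gt_atTop 0] with u hu
  rw [bb, sub_div, ← max_div_div_right hu.le _ (max r₁ r₂),
    ← max_div_div_right hu.le (u * ‖y‖ - r₁), sub_div, sub_div,
    mul_div_cancel_left₀ _ hu.ne', mul_div_cancel_left₀ _ hu.ne']

lemma II_lim (d : ℕ) (hd : 0 < d) (F : Measure ℝ) [IsProbabilityMeasure F]
    (α : ℝ) (hα : (d : ℝ) < α) (hpow : IsPowerLaw F α)
    (r₁ r₂ : ℝ) (hr₁ : 0 ≤ r₁) (hr₂ : 0 ≤ r₂) :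
    Tendsto (fun u => II d F r₁ r₂ u / (u ^ d * tailF F u)) atTop (nhds (cconst d α)) := by
  obtain ⟨β, hβ1, hβ2⟩ := exists_between hα
  have hβ0 : 0 < β := (Nat.cast_nonneg d).trans_lt hβ1
  obtain ⟨C, v0, hC, hv0, hP⟩ := potter F α β hpow hβ0 hβ2
  have key : Tendsto (fun u => ∫ y : Euc d, (F (Ici (bb d r₁ r₂ u y))).toReal / tailF F u)
      atTop (nhds (cconst d α)) := by
    rw [cconst_eq d hd α hα]
    apply tendsto_integral_filter_of_dominated_convergence
      (fun y => C * 2 ^ β * MM d y ^ (-β))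
    · filter_upwards with u
      refine Measurable.aestronglyMeasurable ?_
      refine Measurable.div_const ((Ici_meas F).comp ?_) _
      unfold bb
      fun_prop
    · filter_upwards [eventually_ge_atTop v0, eventually_gt_atTop 0,
        eventually_ge_atTop (4 * (max r₁ r₂ + 1))] with u hu hu0 hu1
      filter_upwards with y
      have hM := MM_ge d hd y
      have hT := tail_pos F α hpow u hu0
      rw [Real.norm_of_nonneg (by positivity), div_le_iff₀ hT]
      calc _ ≤ tailF F (bb d r₁ r₂ u y - 1) := Ici_le_tail F _
        _ ≤ tailF F (u * (MM d y / 2)) := by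
          apply tail_antitone
          have hb : u * MM d y - max r₁ r₂ ≤ bb d r₁ r₂ u y := by
            have a1 := le_max_left r₁ r₂
            have a2 := le_max_right r₁ r₂
            unfold bb MM
            rw [mul_max_of_nonneg _ _ hu0.le, sub_le_iff_le_add]
            refine max_le ?_ ?_
            · have := (le_max_left (u * ‖y‖ - r₁) (u * ‖y - e1 d‖ - r₂)).trans
                (le_max_left _ (max r₁ r₂))
              linarith
            · have := (le_max_right (u * ‖y‖ - r₁) (u * ‖y - e1 d‖ - r₂)).trans
                (le_max_left _ (max r₁ r₂))
              linarith
          nlinarith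
        _ ≤ C * (MM d y / 2) ^ (-β) * tailF F u := hP u hu _ (by linarith)
        _ = _ := by
          rw [Real.div_rpow (by linarith) (by norm_num), Real.rpow_neg (by norm_num : (0:ℝ) ≤ 2)]
          field_simp
    · exact (MM_integrable d hd β hβ1).const_mul _
    · filter_upwards with y
      have hM := MM_ge d hd y
      have l1 := tail_ratio_gen F α hpow (fun u => bb d r₁ r₂ u y) _ (by linarith)
        (by simpa using bb_lim d hd r₁ r₂ 0 y)
      have l2 := tail_ratio_gen F α hpow (fun u => bb d r₁ r₂ u y - 1) _ (by linarith)
        (bb_lim d hd r₁ r₂ 1 y)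
      refine tendsto_of_tendsto_of_tendsto_of_le_of_le' l1 l2 ?_ ?_
      · filter_upwards [eventually_gt_atTop 0] with u hu
        have hT := tail_pos F α hpow u hu
        gcongr
        exact tail_le_Ici F _
      · filter_upwards [eventually_gt_atTop 0] with u hu
        have hT := tail_pos F α hpow u hu
        gcongr
        exact Ici_le_tail F _
  refine key.congr' ?_
  filter_upwards [eventually_gt_atTop 0] with u hu
  have hT := tail_pos F α hpow u hu
  rw [II_eq d F r₁ r₂ u hu, integral_div]
  field_simp

lemma uT_lim (d : ℕ) (F : Measure ℝ) [IsProbabilityMeasure F]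
    (α : ℝ) (hα : (d : ℝ) < α) (hpow : IsPowerLaw F α) :
    Tendsto (fun u => u ^ d * tailF F u) atTop (nhds 0) := by
  obtain ⟨β, hβ1, hβ2⟩ := exists_between hα
  have hβ0 : 0 < β := (Nat.cast_nonneg d).trans_lt hβ1
  obtain ⟨C, v0, hC, hv0, hP⟩ := potter F α β hpow hβ0 hβ2
  have h1 : Tendsto (fun u : ℝ => C * (1 / v0) ^ (-β) * tailF F v0 * u ^ (-(β - d))) atTop
      (nhds 0) := by
    simpa using (tendsto_rpow_neg_atTop (sub_pos.2 hβ1)).const_mul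
      (C * (1 / v0) ^ (-β) * tailF F v0)
  refine tendsto_of_tendsto_of_tendsto_of_le_of_le' tendsto_const_nhds h1 ?_ ?_
  · filter_upwards [eventually_gt_atTop 0] with u hu
    have := tail_pos F α hpow u hu
    positivity
  · filter_upwards [eventually_gt_atTop 0, eventually_ge_atTop v0] with u hu hu0
    have h2 := hP v0 le_rfl (u / v0) (by
      have : 1 ≤ u / v0 := by rwa [one_le_div hv0]
      linarith)
    rw [mul_div_cancel₀ _ hv0.ne'] at h2
    calc u ^ d * tailF F u ≤ u ^ d * (C * (u / v0) ^ (-β) * tailF F v0) := by gcongr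
      _ = _ := by
        rw [show u / v0 = 1 / v0 * u by ring, Real.mul_rpow (by positivity) hu.le,
          show -(β - d) = -β + (d : ℝ) by ring, Real.rpow_add hu, Real.rpow_natCast]
        ring

/-- Retention covariance asymptotics for the large-retained thinning:
`q(|z|,r₁,r₂) ∼ λ c_{α,d} h(r₁) h(r₂) |z|^d F̄(|z|)` as `|z| → ∞`. -/
theorem stmt17 (d : ℕ) (hd : 0 < d) (lam : ℝ) (hlam : 0 < lam)
    (F : Measure ℝ) [IsProbabilityMeasure F] (hsupp : F (Iio 0) = 0)
    (hmom : Integrable (fun r : ℝ => r ^ d) F)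
    (α : ℝ) (hα : (d : ℝ) < α) (hpow : IsPowerLaw F α)
    (r₁ r₂ : ℝ) (hr₁ : 0 ≤ r₁) (hr₂ : 0 ≤ r₂) :
    Tendsto
      (fun z : Euc d =>
        qL d lam F ‖z‖ r₁ r₂ /
          (lam * cconst d α * hL d lam F r₁ * hL d lam F r₂ * ‖z‖ ^ d * tailF F ‖z‖))
      (comap norm atTop) (nhds 1) := by
  have hu : Tendsto (fun z : Euc d => ‖z‖) (comap norm atTop) atTop := tendsto_comap
  suffices h : Tendsto (fun u : ℝ => qL d lam F u r₁ r₂ /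
      (lam * cconst d α * hL d lam F r₁ * hL d lam F r₂ * u ^ d * tailF F u)) atTop (nhds 1) from
    h.comp hu
  have hc := cconst_pos d hd α hα
  have hI := II_lim d hd F α hα hpow r₁ r₂ hr₁ hr₂
  have hI0 : Tendsto (fun u => lam * II d F r₁ r₂ u) atTop (nhds 0) := by
    have := (hI.mul (uT_lim d F α hα hpow)).const_mul lam
    simp only [mul_zero] at this
    refine this.congr' ?_
    filter_upwards [eventually_gt_atTop 0] with u hu
    have := tail_pos F α hpow u hu
    field_simp
  have hne : ∀ᶠ u in atTop, lam * II d F r₁ r₂ u ≠ 0 := by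
    filter_upwards [hI.eventually (lt_mem_nhds hc)] with u hu h0
    have : II d F r₁ r₂ u = 0 := by
      rcases mul_eq_zero.1 h0 with h | h
      · exact absurd h hlam.ne'
      · exact h
    rw [this] at hu
    simp at hu
  have hslope : Tendsto (fun x : ℝ => (Real.exp x - 1) / x) (nhdsWithin 0 {0}ᶜ) (nhds 1) := by
    have := hasDerivAt_iff_tendsto_slope.1 (Real.hasDerivAt_exp 0)
    rw [Real.exp_zero] at this
    refine this.congr fun x => ?_
    simp [slope_def_field]
  have h1 := hslope.comp (tendsto_nhdsWithin_iff.2 ⟨hI0, hne⟩)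
  have h2 := h1.mul (hI.div_const (cconst d α))
  rw [div_self hc.ne', mul_one] at h2
  refine h2.congr' ?_
  filter_upwards [eventually_gt_atTop 0, eventually_gt_atTop (r₁ + r₂), hne] with u hu0 hu1 hu2
  have hT := tail_pos F α hpow u hu0
  have hh1 : 0 < hL d lam F r₁ := Real.exp_pos _
  have hh2 : 0 < hL d lam F r₂ := Real.exp_pos _
  have hII : II d F r₁ r₂ u ≠ 0 := right_ne_zero_of_mul hu2
  rw [qL, h2L, if_neg (not_le.2 hu1), ← II]
  simp only [Function.comp]
  field_simp
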